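/- arXiv:2604.24733 — 2 statements merged into one kernel-verified Lean document; each statement's English description precedes it below -/
import Mathlib

section
/- Fix g ≥ 2. Then ⋀³H is the internal direct sum of the kernel of q₁ : ⋀³H → H and the image of ι : H → ⋀³H; that is, ker(q₁) ∩ range(ι) = 0 and ker(q₁) + range(ι) = ⋀³H. In particular ι is injective and q₁ is surjective, so the short exact sequence 0 → H → ⋀³H → (⋀³H)/H → 0 splits. -/
/-! Common setup: `H g = ℚ^{2g}` with symplectic basis `a₁,…,a_g,b₁,…,b_g`, the standard
symplectic form `ω`, wedges in the exterior powers `⋀[ℚ]^n (H g)`, and the contraction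
maps `q_k : ⋀^{k+2}H → ⋀^k H`. -/

noncomputable section

/-- `H g` is the `2g`-dimensional `ℚ`-vector space with basis indexed by `Fin g ⊕ Fin g`. -/
abbrev H (g : ℕ) : Type := (Fin g ⊕ Fin g) → ℚ

/-- The basis vector `aᵢ` of `H g`. -/
def aVec (g : ℕ) (i : Fin g) : H g := Pi.single (Sum.inl i) 1

/-- The basis vector `bᵢ` of `H g`. -/
def bVec (g : ℕ) (i : Fin g) : H g := Pi.single (Sum.inr i) 1

/-- The standard symplectic form on `H g`: the alternating bilinear form with
`ω(aᵢ,bⱼ) = δᵢⱼ` and `ω(aᵢ,aⱼ) = ω(bᵢ,bⱼ) = 0`. -/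
def ω (g : ℕ) (x y : H g) : ℚ :=
  ∑ i : Fin g, (x (Sum.inl i) * y (Sum.inr i) - x (Sum.inr i) * y (Sum.inl i))

/-- The wedge `v 0 ∧ v 1 ∧ ⋯ ∧ v (n-1)` as an element of the `n`-th exterior power
`⋀[ℚ]^n (H g)`. -/
def wedge (g n : ℕ) (v : Fin n → H g) : ⋀[ℚ]^n (H g) :=
  ⟨ExteriorAlgebra.ιMulti ℚ n v,
    ExteriorAlgebra.ιMulti_range ℚ n (Set.mem_range_self v)⟩

/-- `qFormula g k q` says that the linear map `q : ⋀^{k+2}(H g) → ⋀^k (H g)` is the map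
induced by the alternating multilinear map
`(h₁,…,h_{k+2}) ↦ Σ_{i<j} (−1)^{i+j+1}·ω(hᵢ,hⱼ)·h₁∧⋯∧ĥᵢ∧⋯∧ĥⱼ∧⋯∧h_{k+2}`
(indices written here 1-based, as in the paper; below they are 0-based, which gives the
same signs). -/
def qFormula (g k : ℕ) (q : ⋀[ℚ]^(k + 2) (H g) →ₗ[ℚ] ⋀[ℚ]^k (H g)) : Prop :=
  ∀ v : Fin (k + 2) → H g,
    q (wedge g (k + 2) v) =
      ∑ i : Fin (k + 2), ∑ j : Fin (k + 2),
        if hij : i < j then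
          ((-1 : ℚ) ^ (i.val + j.val + 1) * ω g (v i) (v j)) •
            wedge g k (fun m =>
              v (j.succAbove
                ((⟨i.val, by have h1 := Fin.lt_def.mp hij; have h2 := j.isLt; omega⟩ :
                    Fin (k + 1)).succAbove m)))
        else 0

end

/-- The identification `H ≃ ⋀¹H` sending `h` to the one-fold wedge `h`. -/
noncomputable def wedgeOneEquiv (g : ℕ) : H g ≃ₗ[ℚ] ⋀[ℚ]^1 (H g) :=
  (exteriorPower.oneEquiv ℚ (H g)).symm

theorem wedgeOneEquiv_apply (g : ℕ) (h : H g) : wedgeOneEquiv g h = wedge g 1 ![h] := by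
  rw [wedgeOneEquiv, LinearEquiv.symm_apply_eq]
  exact (exteriorPower.oneEquiv_ιMulti (R := ℚ) ![h]).symm

theorem wedge_one (g : ℕ) (v : Fin 1 → H g) : wedge g 1 v = wedgeOneEquiv g (v 0) := by
  rw [wedgeOneEquiv_apply]
  congr 1
  ext i
  fin_cases i
  rfl

theorem ω_aVec (g : ℕ) (h : H g) (i : Fin g) : ω g h (aVec g i) = -h (Sum.inr i) := by
  simp [ω, aVec, Pi.single_apply]

theorem ω_bVec (g : ℕ) (h : H g) (i : Fin g) : ω g h (bVec g i) = h (Sum.inl i) := by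
  simp [ω, bVec, Pi.single_apply]

/-- The expansion of a vector in the symplectic basis. -/
theorem sum_smul_aVec_add_smul_bVec (g : ℕ) (h : H g) :
    ∑ i : Fin g, (h (Sum.inl i) • aVec g i + h (Sum.inr i) • bVec g i) = h := by
  ext (j | j) <;> simp [aVec, bVec, Pi.single_apply, Finset.sum_apply]

theorem qFormula.apply_wedge_three {g : ℕ} {q : ⋀[ℚ]^3 (H g) →ₗ[ℚ] ⋀[ℚ]^1 (H g)}
    (hq : qFormula g 1 q) (x y z : H g) :
    q (wedge g 3 ![x, y, z]) =
      wedgeOneEquiv g (ω g x y • z - ω g x z • y + ω g y z • x) := by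
  rw [hq]
  simp [Fin.sum_univ_three, wedge_one, Fin.succAbove]
  module

/-- Contracting `h ∧ ω̃` gives `(g - 1) h`. -/
theorem qFormula.apply_sum_wedge {g : ℕ} {q : ⋀[ℚ]^3 (H g) →ₗ[ℚ] ⋀[ℚ]^1 (H g)}
    (hq : qFormula g 1 q) (h : H g) :
    q (∑ i : Fin g, wedge g 3 ![h, aVec g i, bVec g i]) =
      wedgeOneEquiv g (((g : ℚ) - 1) • h) := by
  have hsummand (i : Fin g) : q (wedge g 3 ![h, aVec g i, bVec g i]) =
      wedgeOneEquiv g (h - (h (Sum.inl i) • aVec g i + h (Sum.inr i) • bVec g i)) := by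
    have ha : aVec g i (Sum.inl i) = 1 := by simp [aVec]
    rw [hq.apply_wedge_three, ω_aVec, ω_bVec, ω_bVec, ha]
    congr 1
    module
  simp only [map_sum, hsummand]
  rw [← map_sum, Finset.sum_sub_distrib, sum_smul_aVec_add_smul_bVec, Finset.sum_const,
    Finset.card_fin, sub_smul, one_smul, Nat.cast_smul_eq_nsmul]

/-- Fix `g ≥ 2`.  Then `⋀³H` is the internal direct sum of the kernel of
`q₁ : ⋀³H → H` and the image of `ι : H → ⋀³H`, `ι(h) = h ∧ ω̃`: that is,
`ker(q₁) ∩ range(ι) = 0` and `ker(q₁) + range(ι) = ⋀³H`.  In particular `ι` is injective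
and `q₁` is surjective, so the short exact sequence `0 → H → ⋀³H → (⋀³H)/H → 0` splits. -/
theorem ker_q_one_isCompl_range_iota (g : ℕ) (hg : 2 ≤ g)
    (q₁ : ⋀[ℚ]^3 (H g) →ₗ[ℚ] ⋀[ℚ]^1 (H g)) (hq₁ : qFormula g 1 q₁)
    (ι : H g →ₗ[ℚ] ⋀[ℚ]^3 (H g))
    (hι : ∀ h : H g, ι h = ∑ i : Fin g, wedge g 3 ![h, aVec g i, bVec g i]) :
    LinearMap.ker q₁ ⊓ LinearMap.range ι = ⊥ ∧
    LinearMap.ker q₁ ⊔ LinearMap.range ι = ⊤ ∧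
    Function.Injective ι ∧ Function.Surjective q₁ := by
  have hc : (g : ℚ) - 1 ≠ 0 := by
    have : (2 : ℚ) ≤ g := by exact_mod_cast hg
    linarith
  have key (h : H g) : q₁ (ι h) = wedgeOneEquiv g (((g : ℚ) - 1) • h) := by
    rw [hι, hq₁.apply_sum_wedge]
  have eq_zero {h : H g} (hh : q₁ (ι h) = 0) : h = 0 := by
    rw [key, LinearEquiv.map_eq_zero_iff, smul_eq_zero] at hh
    exact hh.resolve_left hc
  have lift (y : ⋀[ℚ]^1 (H g)) : ∃ h, q₁ (ι h) = y :=
    ⟨((g : ℚ) - 1)⁻¹ • (wedgeOneEquiv g).symm y, by rw [key, smul_inv_smul₀ hc]; simp⟩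
  refine ⟨?_, ?_, ?_, fun y => (lift y).imp' ι fun _ => id⟩
  · rw [eq_bot_iff]
    rintro _ ⟨hx, h, rfl⟩
    simp [eq_zero hx]
  · rw [eq_top_iff]
    intro x _
    obtain ⟨h, hh⟩ := lift (q₁ x)
    refine Submodule.mem_sup.mpr ⟨x - ι h, ?_, ι h, LinearMap.mem_range_self ι h, by simp⟩
    simp [hh]
  · rw [injective_iff_map_eq_zero]
    exact fun h hh => eq_zero (by rw [hh, map_zero])
end

section
/- Fix g ≥ 6. Consider the element ξ ∈ ⋀⁶H given by ξ = (1−g)·(a₁∧a₂∧a₃∧a₄∧a₅∧b₅) + Σᵢ₌₁^g a₁∧a₂∧a₃∧a₄∧aᵢ∧bᵢ. Then q₄(ξ) = −3·(a₁∧a₂∧a₃∧a₄) in ⋀⁴H. (This is the computational core of the lemma showing that the subrepresentation of ⋀²((⋀³H)/H) generated by (a₁∧a₂∧a₃)∧(a₄∧a₅∧b₅) contains a copy of the irreducible Sp_{2g}-representation V_{1⁴}.) -/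
theorem ω_aVec_aVec (g : ℕ) (i j : Fin g) : ω g (aVec g i) (aVec g j) = 0 := by
  simp [ω, aVec]

theorem ω_aVec_bVec (g : ℕ) (i j : Fin g) :
    ω g (aVec g i) (bVec g j) = if i = j then 1 else 0 := by
  simp [ω, aVec, bVec, Pi.single_apply, eq_comm]

theorem wedge_eq_zero_of_eq (g n : ℕ) (v : Fin n → H g) {i j : Fin n} (h : v i = v j)
    (hij : i ≠ j) : wedge g n v = 0 :=
  Subtype.ext ((ExteriorAlgebra.ιMulti ℚ n).map_eq_zero_of_eq v h hij)

/-- Contracting `a_w ∧ a_x ∧ a_y ∧ a_z ∧ aᵢ ∧ bᵢ`, where `i` is none of `w, x, y, z`. -/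
theorem qFormula.apply_wedge_aVec_bVec {g : ℕ} {q : ⋀[ℚ]^6 (H g) →ₗ[ℚ] ⋀[ℚ]^4 (H g)}
    (hq : qFormula g 4 q) {w x y z i : Fin g} (hw : w ≠ i) (hx : x ≠ i) (hy : y ≠ i)
    (hz : z ≠ i) :
    q (wedge g 6 ![aVec g w, aVec g x, aVec g y, aVec g z, aVec g i, bVec g i]) =
      wedge g 4 ![aVec g w, aVec g x, aVec g y, aVec g z] := by
  rw [hq, Finset.sum_eq_single 4, Finset.sum_eq_single 5]
  · rw [dif_pos (by decide)]
    have h : ω g (![aVec g w, aVec g x, aVec g y, aVec g z, aVec g i, bVec g i] 4)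
        (![aVec g w, aVec g x, aVec g y, aVec g z, aVec g i, bVec g i] 5) = 1 :=
      (ω_aVec_bVec g i i).trans (if_pos rfl)
    rw [h, show ((-1 : ℚ) ^ ((4 : Fin 6).val + (5 : Fin 6).val + 1) * 1) = 1 by norm_num,
      one_smul]
    congr 1
    funext m
    fin_cases m <;> rfl
  · intro j _ hj
    rw [dif_neg (by revert j; decide)]
  · simp
  · intro k _ hk
    refine Finset.sum_eq_zero fun j _ => ?_
    split_ifs with hkj
    · have h : ω g (![aVec g w, aVec g x, aVec g y, aVec g z, aVec g i, bVec g i] k)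
          (![aVec g w, aVec g x, aVec g y, aVec g z, aVec g i, bVec g i] j) = 0 := by
        revert hk hkj
        fin_cases k <;> fin_cases j <;> simp [ω_aVec_aVec, ω_aVec_bVec, hw, hx, hy, hz]
      rw [h, mul_zero, zero_smul]
    · rfl
  · simp

/-- Fix `g ≥ 6`.  Consider the element `ξ ∈ ⋀⁶H` given by
`ξ = (1−g)·(a₁∧a₂∧a₃∧a₄∧a₅∧b₅) + Σᵢ₌₁^g a₁∧a₂∧a₃∧a₄∧aᵢ∧bᵢ`.
Then `q₄(ξ) = −3·(a₁∧a₂∧a₃∧a₄)` in `⋀⁴H`.  (Indices below are 0-based.) -/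
theorem q_four_computation (g : ℕ) (hg : 6 ≤ g)
    (q₄ : ⋀[ℚ]^6 (H g) →ₗ[ℚ] ⋀[ℚ]^4 (H g)) (hq₄ : qFormula g 4 q₄) :
    q₄ ((1 - (g : ℚ)) •
          wedge g 6 ![aVec g ⟨0, by omega⟩, aVec g ⟨1, by omega⟩, aVec g ⟨2, by omega⟩,
            aVec g ⟨3, by omega⟩, aVec g ⟨4, by omega⟩, bVec g ⟨4, by omega⟩] +
        ∑ i : Fin g,
          wedge g 6 ![aVec g ⟨0, by omega⟩, aVec g ⟨1, by omega⟩, aVec g ⟨2, by omega⟩,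
            aVec g ⟨3, by omega⟩, aVec g i, bVec g i]) =
      (-3 : ℚ) •
        wedge g 4 ![aVec g ⟨0, by omega⟩, aVec g ⟨1, by omega⟩, aVec g ⟨2, by omega⟩,
          aVec g ⟨3, by omega⟩] := by
  obtain ⟨n, rfl⟩ : ∃ n, g = n + 4 := ⟨g - 4, by omega⟩
  have hne (i : Fin n) (k : ℕ) (hk : k < 4) :
      (⟨k, by omega⟩ : Fin (n + 4)) ≠ i.succ.succ.succ.succ := by
    intro h
    have := congrArg Fin.val h
    simp only [Fin.val_succ] at this
    omega
  have hzero (i : Fin (n + 4)) (hi : i.val < 4) :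
      wedge (n + 4) 6 ![aVec _ ⟨0, by omega⟩, aVec _ ⟨1, by omega⟩, aVec _ ⟨2, by omega⟩,
        aVec _ ⟨3, by omega⟩, aVec _ i, bVec _ i] = 0 := by
    obtain ⟨i, _⟩ := i
    dsimp only at hi
    interval_cases i
    · exact wedge_eq_zero_of_eq _ 6 _ (i := 0) (j := 4) rfl (by decide)
    · exact wedge_eq_zero_of_eq _ 6 _ (i := 1) (j := 4) rfl (by decide)
    · exact wedge_eq_zero_of_eq _ 6 _ (i := 2) (j := 4) rfl (by decide)
    · exact wedge_eq_zero_of_eq _ 6 _ (i := 3) (j := 4) rfl (by decide)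
  rw [map_add, map_smul, hq₄.apply_wedge_aVec_bVec (by simp) (by simp) (by simp) (by simp),
    map_sum]
  simp only [Fin.sum_univ_succ]
  rw [hzero 0 (by simp), hzero (Fin.succ 0) (by simp),
    hzero (Fin.succ (Fin.succ 0)) (by simp only [Fin.val_succ, Fin.val_zero]; decide),
    hzero (Fin.succ (Fin.succ (Fin.succ 0))) (by simp only [Fin.val_succ, Fin.val_zero]; decide),
    Finset.sum_congr rfl fun i _ => hq₄.apply_wedge_aVec_bVec (hne i 0 (by decide))
      (hne i 1 (by decide)) (hne i 2 (by decide)) (hne i 3 (by decide))]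
  simp only [map_zero, zero_add, Finset.sum_const, Finset.card_univ, Fintype.card_fin]
  rw [← Nat.cast_smul_eq_nsmul ℚ, ← add_smul]
  congr 1
  push_cast
  ring
end
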